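/- Let K be a field of characteristic p, κ ∈ F_p^× with associated k, and I ⊂ {1,…,n} a subset of size a. If ℓ is a positive integer with ℓp < ak, then after the substitution z_{i_b} = ((b-1)k-1)κ (b = 1,…,a, where I = {i_1<⋯<i_a}), the coefficient vector Q^{ℓp-1}(z;κ) vanishes: Q^{ℓp-1}(z;κ)|_{S_I} = 0. -/

import Mathlib

open Finset Polynomial

/-- The κ-Pochhammer polynomial `(t;κ)_m = ∏_{i=1}^m (t-(i-1)κ)`. -/
def poch {R : Type*} [CommRing R] (κ t : R) (m : ℕ) : R :=
  ∏ i ∈ Finset.range m, (t - (i : R) * κ)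

/-- The weight polynomial
`Q_c(t,z;κ) = (∏_{j<c}(t-z_j-κ;κ)_k)·(t-z_c-κ;κ)_{k-1}·(∏_{j>c}(t-z_j;κ)_k)`
as an element of `K[z_1,…,z_n][t]`. -/
noncomputable def Qpoly {K : Type*} [Field K] (n k : ℕ) (κ : K) (c : Fin n) :
    Polynomial (MvPolynomial (Fin n) K) :=
  (∏ j ∈ univ.filter (· < c),
      poch (Polynomial.C (MvPolynomial.C κ))
        (Polynomial.X - Polynomial.C (MvPolynomial.X j) -
          Polynomial.C (MvPolynomial.C κ)) k) *
    poch (Polynomial.C (MvPolynomial.C κ))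
      (Polynomial.X - Polynomial.C (MvPolynomial.X c) -
        Polynomial.C (MvPolynomial.C κ)) (k - 1) *
    ∏ j ∈ univ.filter (fun j => c < j),
      poch (Polynomial.C (MvPolynomial.C κ))
        (Polynomial.X - Polynomial.C (MvPolynomial.X j)) k

lemma poch_add' {R : Type*} [CommRing R] (κ t : R) (m n : ℕ) :
    poch κ t (m + n) = poch κ t m * poch κ (t - (m : R) * κ) n := by
  unfold poch
  rw [Finset.prod_range_add]
  congr 1
  refine Finset.prod_congr rfl fun x _ => ?_
  push_cast
  ring

lemma poch_map' {R S : Type*} [CommRing R] [CommRing S] (φ : R →+* S) (κ t : R) (m : ℕ) :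
    φ (poch κ t m) = poch (φ κ) (φ t) m := by
  unfold poch
  simp [map_prod]

lemma poch_prod_dvd {R : Type*} [CommRing R] (κ t : R) (k : ℕ) (hk : 0 < k) {n : ℕ} (c : Fin n)
    (f : Fin n → R) (a : ℕ) : ∀ (i : Fin a → Fin n) (_ : StrictMono i)
    (_ : ∀ b, i b < c → f (i b) = poch κ (t - (((b : ℕ) * k : ℕ) : R) * κ) k)
    (_ : ∀ b, i b = c → f (i b) = poch κ (t - (((b : ℕ) * k : ℕ) : R) * κ) (k - 1))
    (_ : ∀ b, c < i b → f (i b) = poch κ (t - ((((b : ℕ) * k : ℕ) : R) - 1) * κ) k),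
    ((∀ b, i b < c) → poch κ t (a * k) ∣ ∏ b, f (i b)) ∧
      poch κ t (a * k - 1) ∣ ∏ b, f (i b) := by
  induction a with
  | zero => intros; simp [poch]
  | succ a ih =>
    intro i hi h1 h2 h3
    obtain ⟨ihA, ihB⟩ := ih (fun b => i b.castSucc)
      (fun x y h => hi (by simpa using h))
      (fun b h => by simpa using h1 b.castSucc h) (fun b h => by simpa using h2 b.castSucc h)
      (fun b h => by simpa using h3 b.castSucc h)
    have hlt : ∀ b : Fin a, i b.castSucc < i (Fin.last a) := fun b => hi (Fin.castSucc_lt_last b)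
    rw [Fin.prod_univ_castSucc]
    have key : i (Fin.last a) < c →
        poch κ t ((a + 1) * k) ∣ (∏ b : Fin a, f (i b.castSucc)) * f (i (Fin.last a)) := by
      intro h
      rw [h1 _ h, add_mul, one_mul, poch_add']
      exact mul_dvd_mul (ihA fun b => (hlt b).trans h) (by simp)
    refine ⟨fun h => key (h _), ?_⟩
    rcases lt_trichotomy (i (Fin.last a)) c with h | h | h
    · refine dvd_trans ?_ (key h)
      have : (a + 1) * k = ((a + 1) * k - 1) + 1 := by
        have : 0 < (a + 1) * k := by positivity
        omega
      rw [this, poch_add']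
      exact dvd_mul_right _ _
    · rw [h2 _ h, show (a + 1) * k - 1 = a * k + (k - 1) by rw [add_mul]; omega, poch_add']
      exact mul_dvd_mul (ihA fun b => (hlt b).trans_eq h) (by simp)
    · rw [h3 _ h]
      rcases Nat.eq_zero_or_pos a with rfl | ha
      · obtain ⟨k, rfl⟩ : ∃ m, k = 1 + m := ⟨k - 1, by omega⟩
        rw [poch_add']
        simp
      · have hp : 0 < a * k := by positivity
        rw [show (a + 1) * k - 1 = (a * k - 1) + k by rw [add_mul]; omega, poch_add']
        refine mul_dvd_mul ihB ?_
        rw [Nat.cast_sub (by omega)]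
        simp

lemma poch_coeff_zero {R : Type*} [CommRing R] [IsDomain R] (κ : R) (N M : ℕ) (c : ℕ → R)
    (h : poch (C κ) X M ∣ ∑ i ∈ Finset.range N, C (c i) * poch (C κ) (X : R[X]) i) :
    ∀ m, m < M → m < N → c m = 0 := by
  intro m
  induction m using Nat.strong_induction_on with
  | _ m ih =>
  intro hM hN
  have hd : poch (C κ) (X : R[X]) (m + 1) ∣ poch (C κ) X M := by
    obtain ⟨r, rfl⟩ := Nat.exists_eq_add_of_le (Nat.succ_le_of_lt hM)
    rw [Nat.succ_eq_add_one, poch_add' _ _ (m + 1)]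
    exact dvd_mul_right _ _
  have h := hd.trans h
  obtain ⟨r, rfl⟩ := Nat.exists_eq_add_of_le (Nat.succ_le_of_lt hN)
  rw [Nat.succ_eq_add_one, Finset.sum_range_add, Finset.sum_range_succ, Finset.sum_eq_zero] at h
  · have h2 : poch (C κ) (X : R[X]) (m + 1) ∣
        ∑ x ∈ Finset.range r, C (c (m + 1 + x)) * poch (C κ) (X : R[X]) (m + 1 + x) := by
      refine Finset.dvd_sum fun x _ => ?_
      rw [poch_add' _ _ (m + 1)]
      exact (dvd_mul_right _ _).mul_left _
    rw [zero_add, dvd_add_left h2, poch_add', mul_comm] at h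
    have hne : poch (C κ) (X : R[X]) m ≠ 0 := by
      unfold poch
      refine Finset.prod_ne_zero_iff.2 fun x _ => ?_
      have := X_sub_C_ne_zero ((x : R) * κ)
      simpa using this
    rw [mul_comm (C (c m)), mul_comm (poch _ _ 1), mul_dvd_mul_iff_left hne] at h
    have h3 : (X - C ((m : R) * κ)) ∣ C (c m) := by simpa [poch] using h
    simpa using dvd_iff_isRoot.1 h3
  · intro x hx
    have hx := Finset.mem_range.1 hx
    rw [ih x hx (by omega) (by omega)]
    simp

/-- If `ℓp < ak`, the coefficient vector `Q^{ℓp-1}(z;κ)` of the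
Pochhammer-basis expansion of `Q(t,z;κ)` vanishes after the special
restriction `S_I`: `z_{i_b} := ((b-1)k-1)κ` for `I = {i_1 < ⋯ < i_a}`. -/
theorem coeff_vanishes_after_restriction {p : ℕ} [Fact p.Prime] {K : Type*}
    [Field K] [CharP K p]
    (n : ℕ) (k : ℕ) (hk : 0 < k) (hkp : k < p) (κ : K) (hκ : κ * (k : K) = -1)
    (a : ℕ) (ha : 0 < a) (i : Fin a → Fin n) (hi : StrictMono i)
    (ℓ : ℕ) (hℓ0 : 0 < ℓ) (hℓ : ℓ * p < a * k)
    (zs : Fin n → MvPolynomial (Fin n) K)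
    (hz1 : ∀ b : Fin a, zs (i b) =
      MvPolynomial.C ((((b : ℕ) * k : ℕ) : K) - 1) * MvPolynomial.C κ)
    (hz2 : ∀ j : Fin n, (∀ b : Fin a, i b ≠ j) → zs j = MvPolynomial.X j)
    (N : ℕ) (hN : ℓ * p - 1 < N)
    (Qc : Fin n → ℕ → MvPolynomial (Fin n) K)
    (hQc : ∀ c : Fin n, Qpoly n k κ c =
      ∑ i ∈ Finset.range N,
        Polynomial.C (Qc c i) *
          poch (Polynomial.C (MvPolynomial.C κ)) Polynomial.X i) :
    ∀ c : Fin n, MvPolynomial.aeval zs (Qc c (ℓ * p - 1)) = 0 := by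
  intro c
  have hd := congrArg (Polynomial.map (MvPolynomial.aeval zs : _ →ₐ[K] _).toRingHom) (hQc c)
  set φ := Polynomial.mapRingHom (MvPolynomial.aeval zs : _ →ₐ[K] MvPolynomial (Fin n) K).toRingHom
    with hφ
  set κ' : Polynomial (MvPolynomial (Fin n) K) := Polynomial.C (MvPolynomial.C κ) with hκ'
  have hφκ : φ κ' = κ' := by simp [hφ, hκ', MvPolynomial.algebraMap_eq]
  have hφX : φ X = X := by simp [hφ]
  have hφz : ∀ j, φ (C (MvPolynomial.X j)) = C (zs j) := by intro j; simp [hφ]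
  have hφC : ∀ q, φ (C q) = C (MvPolynomial.aeval zs q) := by intro q; simp [hφ]
  have hd : φ (Qpoly n k κ c) = ∑ i ∈ Finset.range N,
      C (MvPolynomial.aeval zs (Qc c i)) * poch κ' X i := by
    rw [hQc c, map_sum]
    refine Finset.sum_congr rfl fun x _ => ?_
    rw [map_mul, poch_map', hφκ, hφX, hφC]
  let f : Fin n → Polynomial (MvPolynomial (Fin n) K) := fun j =>
    if j < c then poch κ' (X - C (zs j) - κ') k
    else if j = c then poch κ' (X - C (zs j) - κ') (k - 1)
    else poch κ' (X - C (zs j)) k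
  have hQ : φ (Qpoly n k κ c) = ∏ j, f j := by
    unfold Qpoly
    rw [map_mul, map_mul, map_prod, map_prod]
    simp only [poch_map', map_sub, hφz, hφX, ← hκ', hφκ]
    rw [← Finset.prod_filter_mul_prod_filter_not univ (· < c) f,
      ← Finset.prod_filter_mul_prod_filter_not (univ.filter (fun j => ¬ j < c)) (· = c) f, mul_assoc]
    have e1 : (univ.filter (fun j => ¬ j < c)).filter (· = c) = {c} := by
      ext j; simp only [mem_filter, mem_univ, true_and, mem_singleton]
      constructor
      · exact fun h => h.2
      · rintro rfl; simp
    have e2 : (univ.filter (fun j => ¬ j < c)).filter (fun j => ¬ j = c) =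
        univ.filter (fun j => c < j) := by
      ext j; simp only [mem_filter, mem_univ, true_and]; omega
    rw [e1, e2, Finset.prod_singleton]
    congr 1
    · refine Finset.prod_congr rfl fun j hj => ?_
      have hj := (Finset.mem_filter.1 hj).2
      simp only [f, if_pos hj]
    · congr 1
      · simp [f]
      · refine Finset.prod_congr rfl fun j hj => ?_
        have hj := (Finset.mem_filter.1 hj).2
        simp only [f, if_neg hj.not_gt, if_neg hj.ne']
  have hC : ∀ b : Fin a, (C (zs (i b)) : Polynomial (MvPolynomial (Fin n) K)) =
      ((((b : ℕ) * k : ℕ) : Polynomial (MvPolynomial (Fin n) K)) - 1) * κ' := by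
    intro b
    rw [hz1, hκ']
    simp
  have hdvd : poch κ' X (a * k - 1) ∣ ∏ b, f (i b) := by
    refine (poch_prod_dvd κ' X k hk c f a i hi ?_ ?_ ?_).2
    · intro b hb
      simp only [f, if_pos hb, hC]
      congr 1; ring
    · intro b hb
      simp only [f, if_neg hb.not_lt, if_pos hb, hC]
      congr 1; ring
    · intro b hb
      simp only [f, if_neg hb.not_gt, if_neg hb.ne', hC]
  have hdvd2 : ∏ b, f (i b) ∣ ∏ j, f j := by
    rw [← Finset.prod_image (s := univ) (g := i) (f := f) (fun x _ y _ h => hi.injective h)]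
    exact Finset.prod_dvd_prod_of_subset _ _ _ (Finset.subset_univ _)
  have hp : 0 < ℓ * p := Nat.mul_pos hℓ0 (Fact.out : p.Prime).pos
  refine poch_coeff_zero (MvPolynomial.C κ) N (a * k - 1)
    (fun m => MvPolynomial.aeval zs (Qc c m)) ?_ _ (by omega) hN
  rw [← hd, hQ]
  exact hdvd.trans hdvd2
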